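/- Let r₀ > 0 and c > 0. Define φ(x) = 1 − r₀/‖x‖ and u_c(x) = 1 + (c − 1)·φ(x) on {x ∈ ℝ³ : ‖x‖ ≥ r₀} (note u_c > 0 there). Then ∫_{‖x‖ ≥ r₀} u_c(x)² · ‖∇( c·φ/u_c )(x)‖² dx = 4π c r₀. (Hence the capacity of the sphere of radius r₀ with respect to the conformal metric u_c⁴ δ equals c times its Euclidean capacity r₀, so by taking c large the capacity of an extension can be made arbitrarily large if the mean curvature boundary condition is dropped.) -/

import Mathlib

open scoped RealInnerProductSpace BigOperators
open MeasureTheory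

noncomputable section

/-- Euclidean 3-space. -/
abbrev E3 : Type := EuclideanSpace ℝ (Fin 3)

/-- Divergence of a vector field: trace of its Fréchet derivative. -/
def div3 (X : E3 → E3) (x : E3) : ℝ :=
  ∑ i : Fin 3, fderiv ℝ X x (EuclideanSpace.single i 1) i

/-- Hessian of a function, viewed as a bilinear form. -/
def hess3 (u : E3 → ℝ) (x a b : E3) : ℝ :=
  fderiv ℝ (fun y => fderiv ℝ u y b) x a

/-- Laplacian: trace of the Hessian. -/
def lap3 (u : E3 → ℝ) (x : E3) : ℝ :=
  ∑ i : Fin 3, hess3 u x (EuclideanSpace.single i 1) (EuclideanSpace.single i 1)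

/-- The gradient of a radial function has norm equal to the absolute radial derivative away from the origin. -/
lemma norm_gradient_comp_norm {E : Type*} [NormedAddCommGroup E] [InnerProductSpace ℝ E]
    [CompleteSpace E] {f : ℝ → ℝ} {f' : ℝ} {x : E} (hx : x ≠ 0)
    (hf : HasDerivAt f f' ‖x‖) : ‖gradient (fun z => f ‖z‖) x‖ = |f'| := by
  have : Nontrivial E := ⟨⟨x, 0, hx⟩⟩
  have hd : DifferentiableAt ℝ (fun z : E => ‖z‖) x :=
    (contDiffAt_norm ℝ hx (n := 1)).differentiableAt one_ne_zero
  have hcomp : HasFDerivAt (fun z : E => f ‖z‖) (f' • fderiv ℝ (fun z : E => ‖z‖) x) x :=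
    hf.comp_hasFDerivAt x hd.hasFDerivAt
  rw [gradient, LinearIsometryEquiv.norm_map, hcomp.fderiv, norm_smul, norm_fderiv_norm hd,
    mul_one, Real.norm_eq_abs]

lemma volume_real_unitBall_E3 :
    (volume : Measure E3).real (Metric.ball 0 1) = 4 / 3 * Real.pi := by
  have h3 : Module.finrank ℝ E3 = 2 * 1 + 1 := by simp
  rw [Measure.real, InnerProductSpace.volume_ball_of_dim_odd h3, h3]
  simp only [ENNReal.ofReal_one, one_pow, one_mul, pow_one, Nat.doubleFactorial]
  norm_num
  ring_nf
  exact ENNReal.toReal_ofReal (by positivity)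

/-- Polar coordinates for radial integrals over the exterior of a ball in `ℝ³`. -/
lemma setIntegral_exterior_comp_norm {r₀ : ℝ} (hr₀ : 0 < r₀) (f : ℝ → ℝ) :
    ∫ x in {x : E3 | r₀ ≤ ‖x‖}, f ‖x‖
      = 4 * Real.pi * ∫ r in Set.Ioi r₀, r ^ 2 * f r := by
  have hmeas : MeasurableSet {x : E3 | r₀ ≤ ‖x‖} :=
    measurableSet_le measurable_const measurable_norm
  have hind : ({x : E3 | r₀ ≤ ‖x‖}.indicator fun x => f ‖x‖)
      = fun x => (Set.Ici r₀).indicator f ‖x‖ := rfl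
  have hsmul : (fun r : ℝ => r ^ 2 • (Set.Ici r₀).indicator f r)
      = (Set.Ici r₀).indicator fun r => r ^ 2 * f r := by
    ext r
    by_cases hr : r ∈ Set.Ici r₀ <;> simp [hr]
  have hinter : Set.Ioi (0 : ℝ) ∩ Set.Ici r₀ = Set.Ici r₀ :=
    Set.inter_eq_right.2 fun r hr => hr₀.trans_le hr
  rw [← integral_indicator hmeas, hind, integral_fun_norm_addHaar, volume_real_unitBall_E3,
    finrank_euclideanSpace_fin, hsmul, setIntegral_indicator measurableSet_Ici, hinter,
    integral_Ici_eq_integral_Ioi]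
  simp only [nsmul_eq_mul, smul_eq_mul]
  push_cast
  ring

lemma affine_denominator_pos {r₀ c r : ℝ} (hr₀ : 0 < r₀) (hc : 0 < c) (hr : r₀ ≤ r) :
    0 < c * (r - r₀) + r₀ :=
  add_pos_of_nonneg_of_pos (mul_nonneg hc.le (sub_nonneg.2 hr)) hr₀

lemma hasDerivAt_affine_denominator (r₀ c r : ℝ) :
    HasDerivAt (fun s => c * (s - r₀) + r₀) c r := by
  simpa using (((hasDerivAt_id r).sub_const r₀).const_mul c).add_const r₀

lemma conformal_factor_eq {r₀ c r : ℝ} (hr : r ≠ 0) :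
    1 + (c - 1) * (1 - r₀ / r) = (c * (r - r₀) + r₀) / r := by
  field_simp
  ring

lemma hasDerivAt_capacitary_potential {r₀ c r : ℝ} (hr₀ : 0 < r₀) (hc : 0 < c) (hr : r₀ ≤ r) :
    HasDerivAt (fun s => c * (1 - r₀ / s) / (1 + (c - 1) * (1 - r₀ / s)))
      (c * r₀ / (c * (r - r₀) + r₀) ^ 2) r := by
  have hD := (affine_denominator_pos hr₀ hc hr).ne'
  have hquot : HasDerivAt (fun s => c * (s - r₀) / (c * (s - r₀) + r₀))
      (c * r₀ / (c * (r - r₀) + r₀) ^ 2) r := by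
    have hnum : HasDerivAt (fun s => c * (s - r₀)) c r := by
      simpa using ((hasDerivAt_id r).sub_const r₀).const_mul c
    exact (hnum.fun_div (hasDerivAt_affine_denominator r₀ c r) hD).congr_deriv (by ring)
  refine hquot.congr_of_eventuallyEq ?_
  filter_upwards [eventually_ne_nhds (hr₀.trans_le hr).ne'] with s hs
  rw [conformal_factor_eq hs, div_div_eq_mul_div]
  congr 1
  field_simp

lemma integral_radial_energy {r₀ c : ℝ} (hr₀ : 0 < r₀) (hc : 0 < c) :
    ∫ r in Set.Ioi r₀, (c * r₀ / (c * (r - r₀) + r₀)) ^ 2 = c * r₀ := by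
  have hderiv : ∀ r ∈ Set.Ici r₀, HasDerivAt (fun s => -(c * r₀ ^ 2) / (c * (s - r₀) + r₀))
      ((c * r₀ / (c * (r - r₀) + r₀)) ^ 2) r := by
    intro r hr
    exact ((hasDerivAt_const r (-(c * r₀ ^ 2))).fun_div (hasDerivAt_affine_denominator r₀ c r)
      (affine_denominator_pos hr₀ hc hr).ne').congr_deriv (by rw [div_pow]; ring)
  have hlim : Filter.Tendsto (fun s => -(c * r₀ ^ 2) / (c * (s - r₀) + r₀)) Filter.atTop
      (nhds 0) := by
    refine Filter.Tendsto.const_div_atTop ?_ _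
    refine Filter.tendsto_atTop_add_const_right _ _ (Filter.Tendsto.const_mul_atTop hc ?_)
    exact Filter.tendsto_atTop_add_const_right _ (-r₀) Filter.tendsto_id
  rw [integral_Ioi_of_hasDerivAt_of_nonneg' hderiv (fun r _ => sq_nonneg _) hlim]
  field_simp
  ring

/-- The capacity of the sphere of radius `r₀` with respect to the conformal metric `u_c⁴ δ`,
where `u_c = 1 + (c-1)φ` and `φ = 1 - r₀/‖x‖`, equals `c·r₀`: the `g_c`-Dirichlet energy of
the `g_c`-capacitary potential `cφ/u_c`, written in Euclidean terms, equals `4π c r₀`. -/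
theorem conformal_capacity_scaling (r₀ c : ℝ) (hr₀ : 0 < r₀) (hc : 0 < c)
    (φ : E3 → ℝ) (hφ : ∀ x : E3, φ x = 1 - r₀ / ‖x‖)
    (u : E3 → ℝ) (hu : ∀ x : E3, u x = 1 + (c - 1) * φ x) :
    ∫ x in {x : E3 | r₀ ≤ ‖x‖},
        (u x) ^ 2 * ‖gradient (fun z => c * φ z / u z) x‖ ^ 2
      = 4 * Real.pi * c * r₀ := by
  have hmeas : MeasurableSet {x : E3 | r₀ ≤ ‖x‖} :=
    measurableSet_le measurable_const measurable_norm
  have hpot : (fun z => c * φ z / u z) = fun z : E3 =>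
      (fun s : ℝ => c * (1 - r₀ / s) / (1 + (c - 1) * (1 - r₀ / s))) ‖z‖ := by
    ext z
    simp only [hu, hφ]
  have hint : ∀ x ∈ {x : E3 | r₀ ≤ ‖x‖},
      u x ^ 2 * ‖gradient (fun z => c * φ z / u z) x‖ ^ 2
        = (fun r : ℝ => (c * r₀ / (c * (r - r₀) + r₀)) ^ 2 / r ^ 2) ‖x‖ := by
    intro x hx
    have hnorm : 0 < ‖x‖ := hr₀.trans_le hx
    have hD := (affine_denominator_pos hr₀ hc hx).ne'
    rw [hpot, norm_gradient_comp_norm (norm_pos_iff.1 hnorm)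
      (hasDerivAt_capacitary_potential hr₀ hc hx), sq_abs, hu, hφ, conformal_factor_eq hnorm.ne']
    field_simp
  rw [setIntegral_congr_fun hmeas hint, setIntegral_exterior_comp_norm hr₀
      (fun r => (c * r₀ / (c * (r - r₀) + r₀)) ^ 2 / r ^ 2),
    setIntegral_congr_fun measurableSet_Ioi (fun r hr =>
      mul_div_cancel₀ _ (pow_ne_zero 2 (hr₀.trans hr).ne')), integral_radial_energy hr₀ hc]
  ring
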